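/- Assume: G connected with incidence matrix B, E = [I_p;0] with p ≥ 1; each ȳ_i in the range of h_i; L the Laplacian of a balanced strongly connected digraph; h_i, f_k, g_i continuously differentiable strictly increasing with range(f_k) = (λ_k⁻, λ_k⁺) and range(g_i) = (u_i⁻, u_i⁺); ū = Q⁻¹(λ*·1_p − r), λ* = (1_nᵀd + 1_pᵀQ⁻¹r)/(1_pᵀQ⁻¹1_p), with ū_i ∈ range(g_i); there exists λ̄ with Bλ̄ = Eū − d and λ̄_k ∈ range(f_k); and the set {1,…,p} of actuated nodes is a zero forcing set for G. Then every solution on [0,∞) of the system T_x ẋ = −B f(μ) + E g(θ) − d; T_μ μ̇ = Bᵀ(h(x) − ȳ); T_θ θ̇ = −Eᵀ(h(x) − ȳ) − (g(θ) − φ); T_φ φ̇ = g(θ) − φ − Q L (Q φ + r) satisfies λ_k⁻ < f_k(μ_k(t)) < λ_k⁺ and u_i⁻ < g_i(θ_i(t)) < u_i⁺ for all t ≥ 0, and converges as t → ∞ to a point (x*, μ*, θ*, φ*) with h(x*) = ȳ, g(θ*) = ū and B f(μ*) = E ū − d. -/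

import Mathlib

open Matrix BigOperators Filter Topology MeasureTheory

/-- An undirected graph on `Fin n` with `m` edges, each edge given an arbitrary
orientation: edge `k` goes from its positive end `pos k` to its negative end `neg k`. -/
structure OrientedGraph (n m : ℕ) where
  pos : Fin m → Fin n
  neg : Fin m → Fin n
  ne_ends : ∀ k, pos k ≠ neg k

namespace OrientedGraph

variable {n m : ℕ}

/-- The oriented incidence matrix `B ∈ ℝ^{n×m}`. -/
def inc (G : OrientedGraph n m) : Matrix (Fin n) (Fin m) ℝ :=
  Matrix.of fun i k => if i = G.pos k then (1 : ℝ) else if i = G.neg k then -1 else 0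

/-- Adjacency in the underlying undirected graph. -/
def Adj (G : OrientedGraph n m) (i j : Fin n) : Prop :=
  ∃ k, (G.pos k = i ∧ G.neg k = j) ∨ (G.pos k = j ∧ G.neg k = i)

/-- Connectedness of the underlying undirected graph. -/
def Connected (G : OrientedGraph n m) : Prop :=
  ∀ i j : Fin n, Relation.ReflTransGen G.Adj i j

end OrientedGraph

/-- The matrix `E = [I_p ; 0_{(n-p)×p}]` selecting the first `p` nodes. -/
def selE (n p : ℕ) : Matrix (Fin n) (Fin p) ℝ :=
  Matrix.of fun i j => if (i : ℕ) = (j : ℕ) then 1 else 0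

/-- Componentwise application of a family of scalar functions. -/
def cw {k : ℕ} (f : Fin k → ℝ → ℝ) (x : Fin k → ℝ) : Fin k → ℝ :=
  fun i => f i (x i)

/-- `λ* = (1ₙᵀ d + 1ₚᵀ Q⁻¹ r)/(1ₚᵀ Q⁻¹ 1ₚ)` for `Q = diag q`. -/
noncomputable def lamStar {n p : ℕ} (q r : Fin p → ℝ) (d : Fin n → ℝ) : ℝ :=
  ((∑ i, d i) + ∑ i, r i / q i) / (∑ i, (q i)⁻¹)

/-- The optimal input `ū = Q⁻¹(λ*·1ₚ − r)`. -/
noncomputable def uOpt {n p : ℕ} (q r : Fin p → ℝ) (d : Fin n → ℝ) : Fin p → ℝ :=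
  fun i => (lamStar q r d - r i) / q i

/-- The cost `C(u) = ½ uᵀQu + rᵀu + s` for `Q = diag q`. -/
noncomputable def cost {p : ℕ} (q r : Fin p → ℝ) (s : ℝ) (u : Fin p → ℝ) : ℝ :=
  (1 / 2) * (∑ i, q i * u i ^ 2) + (∑ i, r i * u i) + s

/-- `L` is the Laplacian matrix of a balanced, strongly connected weighted digraph:
nonpositive off-diagonal entries, zero row sums, zero column sums, and the digraph
whose arcs are the pairs with `L i j < 0` is strongly connected. -/
structure IsBalancedStronglyConnectedLaplacian {p : ℕ} (L : Matrix (Fin p) (Fin p) ℝ) : Prop where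
  offdiag_nonpos : ∀ i j, i ≠ j → L i j ≤ 0
  rowsum : L.mulVec (fun _ => 1) = 0
  colsum : Matrix.vecMul (fun _ => 1) L = 0
  sconn : ∀ i j : Fin p, Relation.ReflTransGen (fun a b => a ≠ b ∧ L a b < 0) i j

/-- One application of the zero-forcing color-change rule: a white node `j` becomes
black if some black node `i` has `j` as its unique white neighbor. -/
def zfStep {n m : ℕ} (G : OrientedGraph n m) (S : Set (Fin n)) : Set (Fin n) :=
  S ∪ {j | ∃ i ∈ S, G.Adj i j ∧ ∀ j', G.Adj i j' → j' ∉ S → j' = j}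

/-- `Z` is a zero forcing set for `G` if iterating the color-change rule starting from
`Z` eventually colors all nodes black. -/
def IsZeroForcingSet {n m : ℕ} (G : OrientedGraph n m) (Z : Set (Fin n)) : Prop :=
  ∃ k : ℕ, (zfStep G)^[k] Z = Set.univ


theorem limit_traj {E : Type*} [NormedAddCommGroup E] [NormedSpace ℝ E] {F : E → E}
    (hF : Continuous F) {K : Set E} (hK : IsCompact K) {z : ℝ → E}
    (hzK : ∀ t, 0 ≤ t → z t ∈ K) (hz : ∀ t, 0 ≤ t → HasDerivAt z (F (z t)) t)
    (U : Ultrafilter ℝ) (hU : (U : Filter ℝ) ≤ atTop) :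
    ∃ y : ℝ → E, (∀ s, Tendsto (fun t => z (t + s)) U (𝓝 (y s))) ∧
      ∀ s, HasDerivAt y (F (y s)) s := by
  have hev : ∀ s : ℝ, ∀ᶠ t in (U : Filter ℝ), 0 ≤ t + s := by
    intro s
    have : ∀ᶠ t : ℝ in atTop, 0 ≤ t + s := by
      filter_upwards [eventually_ge_atTop (-s)] with t ht
      linarith
    exact hU this
  have hex : ∀ s : ℝ, ∃ w ∈ K, Tendsto (fun t => z (t + s)) U (𝓝 w) := by
    intro s
    have := hK.ultrafilter_le_nhds (U.map (fun t => z (t + s))) (by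
      rw [le_principal_iff]
      change ∀ᶠ t in (U : Filter ℝ), z (t + s) ∈ K
      filter_upwards [hev s] with t ht
      exact hzK _ ht)
    obtain ⟨w, hw, h⟩ := this
    exact ⟨w, hw, h⟩
  choose y hyK hy using hex
  refine ⟨y, hy, fun s => ?_⟩
  obtain ⟨C, hC⟩ := hK.exists_bound_of_continuousOn hF.continuousOn
  have hlip : ∀ a b : ℝ, 0 ≤ a → 0 ≤ b → ‖z b - z a‖ ≤ C * ‖b - a‖ := by
    intro a b ha hb
    exact (convex_Ici (0:ℝ)).norm_image_sub_le_of_norm_hasDerivWithin_le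
      (f' := fun t => F (z t))
      (fun t ht => (hz t ht).hasDerivWithinAt) (fun t ht => hC _ (hzK t ht)) ha hb
  have hC0 : 0 ≤ C := (norm_nonneg _).trans (hC _ (hzK 0 le_rfl))
  have hUC := hK.uniformContinuousOn_of_continuous hF.continuousOn
  rw [Metric.uniformContinuousOn_iff] at hUC
  rw [hasDerivAt_iff_isLittleO_nhds_zero, Asymptotics.isLittleO_iff]
  intro ε hε
  obtain ⟨δ, hδ, hUC⟩ := hUC ε hε
  have hη : 0 < δ / (C + 1) := by positivity
  have hCη : C * (δ / (C + 1)) < δ := by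
    rw [mul_div_assoc', div_lt_iff₀ (by positivity)]
    nlinarith
  set η := δ / (C + 1) with hηdef
  filter_upwards [Metric.closedBall_mem_nhds (0:ℝ) hη] with τ hτ
  have hτ' : |τ| ≤ η := by simpa using hτ
  have key : ∀ t : ℝ, 0 ≤ t → 0 ≤ t + τ → ‖z (t + τ) - z t - τ • F (z t)‖ ≤ ε * ‖τ‖ := by
    intro t ht htτ
    have hconv : Convex ℝ (Set.Ici (0:ℝ) ∩ Metric.closedBall t η) :=
      (convex_Ici 0).inter (convex_closedBall t η)
    have := hconv.norm_image_sub_le_of_norm_hasDerivWithin_le (C := ε) (x := t) (y := t + τ)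
      (f := fun u => z u - u • F (z t)) (f' := fun u => F (z u) - (1:ℝ) • F (z t))
      (fun u hu => ((hz u hu.1).sub ((hasDerivAt_id u).smul_const _)).hasDerivWithinAt)
      (fun u hu => by
        rw [one_smul, ← dist_eq_norm]
        refine (hUC _ (hzK u hu.1) _ (hzK t ht) ?_).le
        rw [dist_eq_norm]
        refine (hlip t u ht hu.1).trans_lt (lt_of_le_of_lt ?_ hCη)
        have : ‖u - t‖ ≤ η := by simpa [dist_eq_norm] using hu.2
        gcongr)
      ⟨ht, by simpa using hη.le⟩ ⟨htτ, by simpa using hτ'⟩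
    calc _ = ‖z (t + τ) - (t + τ) • F (z t) - (z t - t • F (z t))‖ := by
          congr 1; rw [add_smul]; abel
      _ ≤ _ := this
      _ = _ := by simp
  have hlim : Tendsto (fun t => ‖z (t + (s + τ)) - z (t + s) - τ • F (z (t + s))‖) U
      (𝓝 ‖y (s + τ) - y s - τ • F (y s)‖) :=
    (((hy _).sub (hy s)).sub (((hF.tendsto _).comp (hy s)).const_smul τ)).norm
  refine le_of_tendsto hlim ?_
  filter_upwards [hev s, hev (s + τ)] with t h1 h2
  have := key (t + s) h1 (by linarith)
  rwa [add_assoc] at this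

noncomputable def pot (s : ℝ → ℝ) (a x : ℝ) : ℝ := ∫ ξ in a..x, (s ξ - s a)

theorem pot_hasDerivAt {s : ℝ → ℝ} (hs : Continuous s) (a x : ℝ) :
    HasDerivAt (pot s a) (s x - s a) x := by
  have : Continuous (fun ξ => s ξ - s a) := by fun_prop
  exact (this.integral_hasStrictDerivAt a x).hasDerivAt

theorem pot_self (s : ℝ → ℝ) (a : ℝ) : pot s a a = 0 := by simp [pot]

theorem pot_nonneg {s : ℝ → ℝ} (hm : StrictMono s) (a x : ℝ) :
    0 ≤ pot s a x := by
  unfold pot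
  rcases le_total a x with h | h
  · exact intervalIntegral.integral_nonneg h fun u hu => sub_nonneg.2 (hm.monotone hu.1)
  · rw [intervalIntegral.integral_symm, ← intervalIntegral.integral_neg]
    exact intervalIntegral.integral_nonneg h fun u hu => by
      have := hm.monotone hu.2
      linarith

theorem pot_shift {s : ℝ → ℝ} (hs : Continuous s) (a b x : ℝ) :
    pot s a x = pot s a b + pot s b x + (s b - s a) * (x - b) := by
  unfold pot
  have hi : ∀ c u v : ℝ, IntervalIntegrable (fun ξ => s ξ - c) volume u v := fun c u v =>
    (by fun_prop : Continuous fun ξ => s ξ - c).intervalIntegrable u v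
  rw [← intervalIntegral.integral_add_adjacent_intervals (hi (s a) a b) (hi (s a) b x)]
  have : ∫ ξ in b..x, (s ξ - s a) = ∫ ξ in b..x, ((s ξ - s b) + (s b - s a)) := by
    congr 1; ext ξ; ring
  rw [this, intervalIntegral.integral_add (hi _ _ _) (by simp)]
  simp
  ring

theorem pot_lower {s : ℝ → ℝ} (hs : Continuous s) (hm : StrictMono s) (a b x : ℝ) :
    (s b - s a) * (x - b) ≤ pot s a x := by
  rw [pot_shift hs a b x]
  linarith [pot_nonneg hm a b, pot_nonneg hm b x]

theorem pot_pos {s : ℝ → ℝ} (hs : Continuous s) (hm : StrictMono s) {a x : ℝ} (h : x ≠ a) :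
    0 < pot s a x := by
  refine lt_of_lt_of_le ?_ (pot_lower hs hm a ((a + x) / 2) x)
  rcases lt_or_gt_of_ne h with h | h
  · exact mul_pos_of_neg_of_neg (sub_neg.2 (hm (by linarith))) (by linarith)
  · exact mul_pos (sub_pos.2 (hm (by linarith))) (by linarith)

theorem pot_coercive {s : ℝ → ℝ} (hs : Continuous s) (hm : StrictMono s) (a c : ℝ) :
    ∃ R : ℝ, ∀ x, pot s a x ≤ c → x ∈ Set.Icc (-R) R := by
  have h1 : 0 < s (a + 1) - s a := sub_pos.2 (hm (by linarith))
  have h2 : 0 < s a - s (a - 1) := sub_pos.2 (hm (by linarith))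
  refine ⟨|a + 1 + c / (s (a + 1) - s a)| + |a - 1 - c / (s a - s (a - 1))|, fun x hx => ?_⟩
  have e1 := (pot_lower hs hm a (a + 1) x).trans hx
  have e2 := (pot_lower hs hm a (a - 1) x).trans hx
  have f1 : x - (a + 1) ≤ c / (s (a + 1) - s a) := by
    rw [le_div_iff₀ h1]; linarith
  have f2 : (a - 1) - x ≤ c / (s a - s (a - 1)) := by
    rw [le_div_iff₀ h2]; linarith
  constructor
  · have := neg_abs_le (a - 1 - c / (s a - s (a - 1)))
    have := abs_nonneg (a + 1 + c / (s (a + 1) - s a))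
    linarith
  · have := le_abs_self (a + 1 + c / (s (a + 1) - s a))
    have := abs_nonneg (a - 1 - c / (s a - s (a - 1)))
    linarith

noncomputable def lyap {ι : Type*} [Fintype ι] (σ : ι → ℝ → ℝ) (T zb z : ι → ℝ) : ℝ :=
  ∑ i, T i * pot (σ i) (zb i) (z i)

section
variable {ι : Type*} [Fintype ι] {σ : ι → ℝ → ℝ} {T : ι → ℝ}

theorem lyap_continuous (hσ : ∀ i, Continuous (σ i)) (zb : ι → ℝ) :
    Continuous (lyap σ T zb) := by
  unfold lyap
  refine continuous_finsetSum _ fun i _ => continuous_const.mul ?_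
  have : Continuous (pot (σ i) (zb i)) :=
    continuous_iff_continuousAt.2 fun x => (pot_hasDerivAt (hσ i) (zb i) x).continuousAt
  exact this.comp (continuous_apply i)

theorem lyap_term_le (hm : ∀ i, StrictMono (σ i)) (hT : ∀ i, 0 < T i) (zb z : ι → ℝ) (i : ι) :
    T i * pot (σ i) (zb i) (z i) ≤ lyap σ T zb z :=
  Finset.single_le_sum (f := fun i => T i * pot (σ i) (zb i) (z i))
    (fun j _ => mul_nonneg (hT j).le (pot_nonneg (hm j) _ _)) (Finset.mem_univ i)

theorem lyap_nonneg (hm : ∀ i, StrictMono (σ i)) (hT : ∀ i, 0 < T i) (zb z : ι → ℝ) :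
    0 ≤ lyap σ T zb z :=
  Finset.sum_nonneg fun j _ => mul_nonneg (hT j).le (pot_nonneg (hm j) _ _)

theorem lyap_hasDerivAt (hσ : ∀ i, Continuous (σ i)) (hT : ∀ i, 0 < T i) (zb : ι → ℝ)
    {F : (ι → ℝ) → ι → ℝ} {z : ℝ → ι → ℝ} {t : ℝ}
    (hz : ∀ i, HasDerivAt (fun s => z s i) (F (z t) i / T i) t) :
    HasDerivAt (fun s => lyap σ T zb (z s))
      (∑ i, (σ i (z t i) - σ i (zb i)) * F (z t) i) t := by
  unfold lyap
  have h1 : ∀ i ∈ (Finset.univ : Finset ι), HasDerivAt (fun s => T i * pot (σ i) (zb i) (z s i))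
      (T i * ((σ i (z t i) - σ i (zb i)) * (F (z t) i / T i))) t := fun i _ =>
    HasDerivAt.const_mul (T i)
      (HasDerivAt.comp (h₂ := pot (σ i) (zb i)) t (pot_hasDerivAt (hσ i) (zb i) (z t i)) (hz i))
  refine (HasDerivAt.fun_sum h1).congr_deriv ?_
  refine Finset.sum_congr rfl fun i _ => ?_
  have := (hT i).ne'
  field_simp

theorem abstract_lasalle (hσ : ∀ i, Continuous (σ i)) (hm : ∀ i, StrictMono (σ i))
    (hT : ∀ i, 0 < T i) {F : (ι → ℝ) → ι → ℝ} (hF : Continuous F) (Q : (ι → ℝ) → Prop)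
    (ha : ∀ zb, Q zb → ∀ z, ∑ i, (σ i (z i) - σ i (zb i)) * F z i ≤ 0)
    (hb : ∃ zb, Q zb)
    (hc : ∀ zb, Q zb → ∀ y : ℝ → ι → ℝ,
      (∀ t i, HasDerivAt (fun s => y s i) (F (y t) i / T i) t) →
      (∀ t, ∑ i, (σ i (y t i) - σ i (zb i)) * F (y t) i = 0) → Q (y 0))
    {z : ℝ → ι → ℝ}
    (hz : ∀ t, 0 ≤ t → ∀ i, HasDerivAt (fun s => z s i) (F (z t) i / T i) t) :
    ∃ zs, Q zs ∧ Tendsto z atTop (𝓝 zs) := by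
  -- monotonicity of each Lyapunov function
  have hmono : ∀ zb, Q zb → AntitoneOn (fun t => lyap σ T zb (z t)) (Set.Ici 0) := by
    intro zb hQ
    have hd := fun t (ht : 0 ≤ t) => lyap_hasDerivAt hσ hT zb (F := F) (hz t ht)
    refine antitoneOn_of_deriv_nonpos (convex_Ici 0)
      (fun t ht => (hd t ht).continuousAt.continuousWithinAt) 
      (fun t ht => (hd t (interior_subset ht)).differentiableAt.differentiableWithinAt)
      (fun t ht => ?_)
    rw [(hd t (interior_subset ht)).deriv]
    exact ha zb hQ _
  have hlim : ∀ zb, Q zb → ∃ l, Tendsto (fun t => lyap σ T zb (z t)) atTop (𝓝 l) := by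
    intro zb hQ
    have hanti : Antitone (fun t => lyap σ T zb (z (max t 0))) := fun a b hab =>
      hmono zb hQ (le_max_right a 0) (le_max_right b 0) (max_le_max_right 0 hab)
    refine ⟨_, (tendsto_atTop_ciInf hanti
      ⟨0, by rintro _ ⟨t, rfl⟩; exact lyap_nonneg hm hT _ _⟩).congr' ?_⟩
    filter_upwards [eventually_ge_atTop 0] with t ht
    rw [max_eq_left ht]
  obtain ⟨zb, hQ⟩ := hb
  have hR : ∀ i, ∃ R : ℝ, ∀ x, pot (σ i) (zb i) x ≤ lyap σ T zb (z 0) / T i →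
      x ∈ Set.Icc (-R) R := fun i => pot_coercive (hσ i) (hm i) _ _
  choose R hR using hR
  have hK : IsCompact (Set.pi Set.univ fun i => Set.Icc (-R i) (R i)) :=
    isCompact_univ_pi fun i => isCompact_Icc
  set K := Set.pi Set.univ fun i => Set.Icc (-R i) (R i) with hKdef
  have hzK : ∀ t, 0 ≤ t → z t ∈ K := by
    intro t ht i _
    refine hR i _ ?_
    rw [le_div_iff₀ (hT i), mul_comm]
    exact (lyap_term_le hm hT zb (z t) i).trans (hmono zb hQ (Set.mem_Ici.2 le_rfl) ht ht)
  have hF' : Continuous (fun z i => F z i / T i) := by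
    refine continuous_pi fun i => ?_
    exact ((continuous_apply i).comp hF).div_const _
  obtain ⟨y, hy, hyd⟩ := limit_traj (F := fun z i => F z i / T i) hF' hK hzK
    (fun t ht => hasDerivAt_pi.2 (hz t ht)) (Ultrafilter.of atTop) (Ultrafilter.of_le _)
  have hyd' : ∀ t i, HasDerivAt (fun s => y s i) (F (y t) i / T i) t :=
    fun t i => hasDerivAt_pi.1 (hyd t) i
  obtain ⟨l, hl⟩ := hlim zb hQ
  have hconst : ∀ s, lyap σ T zb (y s) = l := by
    intro s
    have h1 : Tendsto (fun t => lyap σ T zb (z (t + s))) (Ultrafilter.of (atTop : Filter ℝ))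
        (𝓝 (lyap σ T zb (y s))) := ((lyap_continuous hσ zb).tendsto _).comp (hy s)
    have h2 : Tendsto (fun t => lyap σ T zb (z (t + s))) (Ultrafilter.of (atTop : Filter ℝ))
        (𝓝 l) :=
      (hl.comp (tendsto_atTop_add_const_right _ s tendsto_id)).mono_left (Ultrafilter.of_le _)
    exact tendsto_nhds_unique h1 h2
  have hdis : ∀ t, ∑ i, (σ i (y t i) - σ i (zb i)) * F (y t) i = 0 := by
    intro t
    have h1 := lyap_hasDerivAt hσ hT zb (F := F) (hyd' t)
    have h2 : HasDerivAt (fun s => lyap σ T zb (y s)) 0 t := by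
      simp only [hconst]; exact hasDerivAt_const t l
    exact h1.unique h2
  have hQ0 := hc zb hQ y hyd' hdis
  refine ⟨y 0, hQ0, ?_⟩
  obtain ⟨l', hl'⟩ := hlim (y 0) hQ0
  have hl0 : l' = 0 := by
    have h1 : Tendsto (fun t => lyap σ T (y 0) (z (t + 0))) (Ultrafilter.of (atTop : Filter ℝ))
        (𝓝 (lyap σ T (y 0) (y 0))) := ((lyap_continuous hσ (y 0)).tendsto _).comp (hy 0)
    simp only [add_zero] at h1
    rw [tendsto_nhds_unique (hl'.mono_left (Ultrafilter.of_le _)) h1]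
    simp [lyap, pot_self]
  subst hl0
  refine hK.tendsto_nhds_of_unique_mapClusterPt
    ((eventually_ge_atTop 0).mono fun t ht => hzK t ht) ?_
  intro w _ hw
  have h3 : MapClusterPt (lyap σ T (y 0) w) atTop (fun t => lyap σ T (y 0) (z t)) :=
    hw.continuousAt_comp (lyap_continuous hσ (y 0)).continuousAt
  have h4 : lyap σ T (y 0) w = 0 := by
    have := h3.clusterPt.mono hl'
    exact eq_of_nhds_neBot this
  funext i
  by_contra hne
  have h5 := lyap_term_le hm hT (y 0) w i
  have h6 := mul_pos (hT i) (pot_pos (hσ i) (hm i) hne)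
  linarith

end

theorem const_of_deriv_zero {u : ℝ → ℝ} (hu : ∀ t, HasDerivAt u 0 t) (s t : ℝ) : u s = u t :=
  is_const_of_deriv_eq_zero (fun t => (hu t).differentiableAt) (fun t => (hu t).deriv) s t

theorem incT_mulVec {n m : ℕ} (G : OrientedGraph n m) (v : Fin n → ℝ) (k : Fin m) :
    (G.inc)ᵀ.mulVec v k = v (G.pos k) - v (G.neg k) := by
  have h1 : ∀ i, G.inc i k * v i =
      (if i = G.pos k then v i else 0) - (if i = G.neg k then v i else 0) := by
    intro i
    have := G.ne_ends k
    simp only [OrientedGraph.inc, Matrix.of_apply]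
    split_ifs with h h' <;> simp_all
  simp only [Matrix.mulVec, dotProduct, Matrix.transpose_apply, h1, Finset.sum_sub_distrib]
  simp

theorem zf_step {n m : ℕ} (G : OrientedGraph n m) (f : Fin m → ℝ → ℝ)
    (hf : ∀ k, StrictMono (f k)) (Tm : Fin m → ℝ) (hTm : ∀ k, 0 < Tm k)
    (a : ℝ → Fin n → ℝ) (M : ℝ → Fin m → ℝ)
    (hM : ∀ t k, HasDerivAt (fun s => M s k) (((G.inc)ᵀ.mulVec (a t)) k / Tm k) t)
    (S : Set (Fin n)) (hS : ∀ i ∈ S, ∀ t, a t i = 0)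
    (hconst : ∀ i ∈ S, ∀ s t, (G.inc.mulVec (cw f (M s))) i = (G.inc.mulVec (cw f (M t))) i) :
    ∀ j ∈ zfStep G S, ∀ t, a t j = 0 := by
  intro j hj
  by_cases hjS : j ∈ S
  · exact hS j hjS
  obtain ⟨i, hi, ⟨k0, hk0⟩, huniq⟩ := hj.resolve_left hjS
  have hij : i ≠ j := fun h => hjS (h ▸ hi)
  have hzero : ∀ j', G.Adj i j' → j' ≠ j → ∀ t, a t j' = 0 := by
    intro j' h1 h2
    refine hS j' ?_
    by_contra h3
    exact h2 (huniq j' h1 h3)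
  have hcl : ∀ k, (G.inc i k = 0) ∨
      ((G.inc i k = 1 ∨ G.inc i k = -1) ∧
        ((∀ t, (G.inc)ᵀ.mulVec (a t) k = 0) ∨
          ∀ t, G.inc i k * (G.inc)ᵀ.mulVec (a t) k = - a t j)) := by
    intro k
    have hne := G.ne_ends k
    simp only [incT_mulVec]
    by_cases h1 : i = G.pos k
    · have hB : G.inc i k = 1 := by simp [OrientedGraph.inc, h1]
      refine Or.inr ⟨Or.inl hB, ?_⟩
      rw [hB, ← h1]
      by_cases h2 : G.neg k = j
      · right; intro t; rw [h2, hS i hi]; ring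
      · left; intro t
        rw [hS i hi, hzero (G.neg k) ⟨k, Or.inl ⟨h1.symm, rfl⟩⟩ h2]; ring
    · by_cases h1' : i = G.neg k
      · have hB : G.inc i k = -1 := by simp [OrientedGraph.inc, h1, ← h1']
        refine Or.inr ⟨Or.inr hB, ?_⟩
        rw [hB, ← h1']
        by_cases h2 : G.pos k = j
        · right; intro t; rw [h2, hS i hi]; ring
        · left; intro t
          rw [hS i hi, hzero (G.pos k) ⟨k, Or.inr ⟨rfl, h1'.symm⟩⟩ h2]; ring
      · left; simp [OrientedGraph.inc, h1, h1']
  have hk0' : (G.inc i k0 = 1 ∨ G.inc i k0 = -1) ∧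
      ∀ t, G.inc i k0 * (G.inc)ᵀ.mulVec (a t) k0 = - a t j := by
    rcases hk0 with ⟨h1, h2⟩ | ⟨h1, h2⟩
    · have hB : G.inc i k0 = 1 := by simp [OrientedGraph.inc, h1]
      refine ⟨Or.inl hB, fun t => ?_⟩
      rw [hB, incT_mulVec, h1, h2, hS i hi]; ring
    · have hB : G.inc i k0 = -1 := by
        simp [OrientedGraph.inc, h1, h2, hij]
      refine ⟨Or.inr hB, fun t => ?_⟩
      rw [hB, incT_mulVec, h1, h2, hS i hi]; ring
  have hN : ∀ k t, HasDerivAt (fun s => G.inc i k * Tm k * M s k)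
      (G.inc i k * (G.inc)ᵀ.mulVec (a t) k) t := by
    intro k t
    refine ((hM t k).const_mul (G.inc i k * Tm k)).congr_deriv ?_
    have := (hTm k).ne'
    field_simp
  have hinc : ∀ k, (∀ t, G.inc i k * (G.inc)ᵀ.mulVec (a t) k = - a t j) → ∀ s t,
      G.inc i k * Tm k * M s k - G.inc i k * Tm k * M t k =
      G.inc i k0 * Tm k0 * M s k0 - G.inc i k0 * Tm k0 * M t k0 := by
    intro k hk s t
    have : G.inc i k * Tm k * M s k - G.inc i k0 * Tm k0 * M s k0 =
        G.inc i k * Tm k * M t k - G.inc i k0 * Tm k0 * M t k0 := const_of_deriv_zero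
      (u := fun s => G.inc i k * Tm k * M s k - G.inc i k0 * Tm k0 * M s k0) (fun t => by
        have := (hN k t).sub (hN k0 t)
        rwa [hk, hk0'.2, sub_self] at this) s t
    linarith
  have hmono : ∀ k s t, G.inc i k = 1 ∨ G.inc i k = -1 →
      G.inc i k * Tm k * M s k < G.inc i k * Tm k * M t k →
      G.inc i k * f k (M s k) < G.inc i k * f k (M t k) := by
    intro k s t hB hlt
    rcases hB with hB | hB
    · rw [hB] at hlt ⊢
      have : M s k < M t k := by
        have := hTm k
        nlinarith
      linarith [hf k this]
    · rw [hB] at hlt ⊢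
      have : M t k < M s k := by
        have := hTm k
        nlinarith
      linarith [hf k this]
  have hnot : ∀ s t, ¬ (G.inc i k0 * Tm k0 * M s k0 < G.inc i k0 * Tm k0 * M t k0) := by
    intro s t hlt
    refine absurd (hconst i hi s t) (ne_of_lt ?_)
    simp only [Matrix.mulVec, dotProduct, cw]
    refine Finset.sum_lt_sum (fun k _ => ?_) ⟨k0, Finset.mem_univ _, hmono k0 s t hk0'.1 hlt⟩
    rcases hcl k with h0 | ⟨hB, h0 | h0⟩
    · simp [h0]
    · have : M s k = M t k := const_of_deriv_zero (u := fun s => M s k) (fun t => by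
        have := hM t k
        rwa [h0, zero_div] at this) s t
      rw [this]
    · exact (hmono k s t hB (by linarith [hinc k h0 s t])).le
  intro t
  have h1 := hN k0 t
  rw [hk0'.2] at h1
  have h2 : HasDerivAt (fun s => G.inc i k0 * Tm k0 * M s k0) 0 t := by
    have : (fun s => G.inc i k0 * Tm k0 * M s k0) = fun _ => G.inc i k0 * Tm k0 * M 0 k0 := by
      funext s
      exact le_antisymm (not_lt.1 (hnot 0 s)) (not_lt.1 (hnot s 0))
    rw [this]; exact hasDerivAt_const _ _
  linarith [h1.unique h2]

theorem lap_quad {p : ℕ} {L : Matrix (Fin p) (Fin p) ℝ}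
    (hL : IsBalancedStronglyConnectedLaplacian L) (w : Fin p → ℝ) :
    w ⬝ᵥ L.mulVec w = ∑ i, ∑ j, (-(L i j) / 2) * (w i - w j) ^ 2 := by
  have hr : ∀ i, ∑ j, L i j = 0 := fun i => by
    have := congrFun hL.rowsum i
    simpa [Matrix.mulVec, dotProduct] using this
  have hc : ∀ j, ∑ i, L i j = 0 := fun i => by
    have := congrFun hL.colsum i
    simpa [Matrix.vecMul, dotProduct] using this
  have h1 : ∀ i j, (-(L i j) / 2) * (w i - w j) ^ 2 =
      w i * (L i j * w j) + (-(w i ^ 2 / 2) * L i j + -(w j ^ 2 / 2) * L i j) := by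
    intro i j; ring
  simp only [h1, Finset.sum_add_distrib]
  have h2 : ∑ i, ∑ j, -(w i ^ 2 / 2) * L i j = 0 := by
    simp only [← Finset.mul_sum, hr, mul_zero, Finset.sum_const_zero]
  have h3 : ∑ i, ∑ j, -(w j ^ 2 / 2) * L i j = 0 := by
    rw [Finset.sum_comm]
    simp only [← Finset.mul_sum, hc, mul_zero, Finset.sum_const_zero]
  rw [h2, h3]
  simp [Matrix.mulVec, dotProduct, Finset.mul_sum]

theorem lap_term_nonneg {p : ℕ} {L : Matrix (Fin p) (Fin p) ℝ}
    (hL : IsBalancedStronglyConnectedLaplacian L) (w : Fin p → ℝ) (i j : Fin p) :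
    0 ≤ (-(L i j) / 2) * (w i - w j) ^ 2 := by
  by_cases h : i = j
  · simp [h]
  · have := hL.offdiag_nonpos i j h
    exact mul_nonneg (by linarith) (sq_nonneg _)

theorem lap_nonneg {p : ℕ} {L : Matrix (Fin p) (Fin p) ℝ}
    (hL : IsBalancedStronglyConnectedLaplacian L) (w : Fin p → ℝ) :
    0 ≤ w ⬝ᵥ L.mulVec w := by
  rw [lap_quad hL]
  exact Finset.sum_nonneg fun i _ => Finset.sum_nonneg fun j _ => lap_term_nonneg hL w i j

theorem lap_zero {p : ℕ} {L : Matrix (Fin p) (Fin p) ℝ}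
    (hL : IsBalancedStronglyConnectedLaplacian L) (w : Fin p → ℝ)
    (h : w ⬝ᵥ L.mulVec w = 0) (i j : Fin p) : w i = w j := by
  rw [lap_quad hL, Finset.sum_eq_zero_iff_of_nonneg
    (fun i _ => Finset.sum_nonneg fun j _ => lap_term_nonneg hL w i j)] at h
  have h1 : ∀ a b, L a b < 0 → w a = w b := by
    intro a b hab
    have := (Finset.sum_eq_zero_iff_of_nonneg (fun j _ => lap_term_nonneg hL w a j)).1
      (h a (Finset.mem_univ _)) b (Finset.mem_univ _)
    rcases mul_eq_zero.1 this with h2 | h2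
    · linarith
    · exact sub_eq_zero.1 (pow_eq_zero_iff two_ne_zero |>.1 h2)
  induction hL.sconn i j with
  | refl => rfl
  | tail _ hbc ih => exact ih.trans (h1 _ _ hbc.2)

theorem lap_const {p : ℕ} {L : Matrix (Fin p) (Fin p) ℝ}
    (hL : IsBalancedStronglyConnectedLaplacian L) (w : Fin p → ℝ)
    (h : ∀ i j, w i = w j) : L.mulVec w = 0 := by
  funext i
  have hr := congrFun hL.rowsum i
  simp only [Matrix.mulVec, dotProduct, mul_one, Pi.zero_apply] at hr ⊢
  rw [Finset.sum_congr rfl fun j _ => by rw [h j i], ← Finset.sum_mul, hr, zero_mul]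

theorem q_uOpt {n p : ℕ} (q r : Fin p → ℝ) (hq : ∀ i, 0 < q i) (d : Fin n → ℝ) (i : Fin p) :
    q i * uOpt q r d i + r i = lamStar q r d := by
  have := (hq i).ne'
  unfold uOpt
  field_simp
  ring

theorem dissip {n m p : ℕ} (B : Matrix (Fin n) (Fin m) ℝ) (E : Matrix (Fin n) (Fin p) ℝ)
    (q r : Fin p → ℝ) {L : Matrix (Fin p) (Fin p) ℝ}
    (hL : IsBalancedStronglyConnectedLaplacian L) (d a : Fin n → ℝ) (fm lb : Fin m → ℝ)
    (gt ph ub : Fin p → ℝ) (ls : ℝ) (hub : ∀ i, q i * ub i + r i = ls)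
    (hlb : B.mulVec lb = E.mulVec ub - d) :
    a ⬝ᵥ (-(B.mulVec fm) + E.mulVec gt - d) + ((fm - lb) ⬝ᵥ (Bᵀ.mulVec a) +
      ((gt - ub) ⬝ᵥ (-(Eᵀ.mulVec a) - (gt - ph)) +
       (ph - ub) ⬝ᵥ (gt - ph -
        (Matrix.diagonal q).mulVec (L.mulVec ((Matrix.diagonal q).mulVec ph + r))))) =
    -((gt - ph) ⬝ᵥ (gt - ph)) - ((Matrix.diagonal q).mulVec ph + r) ⬝ᵥ
      L.mulVec ((Matrix.diagonal q).mulVec ph + r) := by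
  have hd : d = E.mulVec ub - B.mulVec lb := by rw [hlb]; abel
  have e1 : (fm - lb) ⬝ᵥ (Bᵀ.mulVec a) = a ⬝ᵥ B.mulVec (fm - lb) := by
    rw [Matrix.mulVec_transpose, dotProduct_comm, ← Matrix.dotProduct_mulVec]
  have e2 : (gt - ub) ⬝ᵥ (Eᵀ.mulVec a) = a ⬝ᵥ E.mulVec (gt - ub) := by
    rw [Matrix.mulVec_transpose, dotProduct_comm, ← Matrix.dotProduct_mulVec]
  set w := (Matrix.diagonal q).mulVec ph + r with hw
  have e3 : (ph - ub) ⬝ᵥ (Matrix.diagonal q).mulVec (L.mulVec w) = w ⬝ᵥ L.mulVec w := by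
    have h1 : (fun _ => (1:ℝ)) ⬝ᵥ L.mulVec w = 0 := by
      rw [Matrix.dotProduct_mulVec, hL.colsum, zero_dotProduct]
    have h2 : (ph - ub) ⬝ᵥ (Matrix.diagonal q).mulVec (L.mulVec w) =
        w ⬝ᵥ L.mulVec w - ls * ((fun _ => (1:ℝ)) ⬝ᵥ L.mulVec w) := by
      simp only [dotProduct, Matrix.mulVec_diagonal, Finset.mul_sum, ← Finset.sum_sub_distrib]
      refine Finset.sum_congr rfl fun i _ => ?_
      have h3 : w i = q i * ph i + r i := by simp [hw, Matrix.mulVec_diagonal]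
      rw [h3, Pi.sub_apply, ← hub i]
      ring
    rw [h2, h1]; ring
  rw [e1, hd, dotProduct_sub (gt - ub), dotProduct_neg, e2, dotProduct_sub (ph - ub), e3]
  simp only [Matrix.mulVec_sub, dotProduct_sub, dotProduct_add, dotProduct_neg, sub_dotProduct]
  ring

theorem sum_inc {n m : ℕ} (G : OrientedGraph n m) (v : Fin m → ℝ) :
    ∑ i, G.inc.mulVec v i = 0 := by
  have h := incT_mulVec G (fun _ => 1)
  have h1 : ∑ i, G.inc.mulVec v i = (fun _ => (1:ℝ)) ⬝ᵥ G.inc.mulVec v := by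
    simp [dotProduct]
  rw [h1, Matrix.dotProduct_mulVec, ← Matrix.mulVec_transpose]
  simp [dotProduct, h]

theorem selET {n p : ℕ} (hpn : p ≤ n) (v : Fin n → ℝ) (j : Fin p) :
    (selE n p)ᵀ.mulVec v j = v (Fin.castLE hpn j) := by
  simp only [Matrix.mulVec, dotProduct, Matrix.transpose_apply, selE, Matrix.of_apply]
  rw [Finset.sum_eq_single (Fin.castLE hpn j)]
  · simp
  · intro b _ hb
    rw [if_neg, zero_mul]
    intro h
    exact hb (Fin.ext (by simpa using h))
  · simp

theorem sum_selE {n p : ℕ} (hpn : p ≤ n) (u : Fin p → ℝ) :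
    ∑ i, (selE n p).mulVec u i = ∑ j, u j := by
  have h := selET hpn (fun _ => 1)
  have h1 : ∑ i, (selE n p).mulVec u i = (fun _ => (1:ℝ)) ⬝ᵥ (selE n p).mulVec u := by
    simp [dotProduct]
  rw [h1, Matrix.dotProduct_mulVec, ← Matrix.mulVec_transpose]
  simp [dotProduct, h]

theorem invariant_analysis {n m p : ℕ} (hp : 0 < p) (hpn : p ≤ n)
    (G : OrientedGraph n m)
    (h : Fin n → ℝ → ℝ) (hh : ∀ i, StrictMono (h i))
    (f : Fin m → ℝ → ℝ) (hf : ∀ k, StrictMono (f k))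
    (g : Fin p → ℝ → ℝ) (hg : ∀ i, StrictMono (g i))
    (q r : Fin p → ℝ) (hq : ∀ i, 0 < q i) (d ybar : Fin n → ℝ)
    (L : Matrix (Fin p) (Fin p) ℝ) (hL : IsBalancedStronglyConnectedLaplacian L)
    (hzf : IsZeroForcingSet G {i : Fin n | (i : ℕ) < p})
    (Tx : Fin n → ℝ) (Tm : Fin m → ℝ) (Tth Tph : Fin p → ℝ)
    (hTx : ∀ i, 0 < Tx i) (hTm : ∀ k, 0 < Tm k)
    (hTth : ∀ i, 0 < Tth i)
    (x : ℝ → Fin n → ℝ) (μ : ℝ → Fin m → ℝ) (θ φ : ℝ → Fin p → ℝ)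
    (hxode : ∀ t, ∀ i, HasDerivAt (fun s => x s i)
      (((-(G.inc.mulVec (cw f (μ t))) + (selE n p).mulVec (cw g (θ t)) - d) i) / Tx i) t)
    (hμode : ∀ t, ∀ k, HasDerivAt (fun s => μ s k)
      ((((G.inc)ᵀ.mulVec (cw h (x t) - ybar)) k) / Tm k) t)
    (hθode : ∀ t, ∀ i, HasDerivAt (fun s => θ s i)
      (((-((selE n p)ᵀ.mulVec (cw h (x t) - ybar)) - (cw g (θ t) - φ t)) i) / Tth i) t)
    (hφode : ∀ t, ∀ i, HasDerivAt (fun s => φ s i)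
      (((cw g (θ t) - φ t -
        (Matrix.diagonal q).mulVec (L.mulVec ((Matrix.diagonal q).mulVec (φ t) + r))) i)
        / Tph i) t)
    (hdis : ∀ t, -((cw g (θ t) - φ t) ⬝ᵥ (cw g (θ t) - φ t)) -
      ((Matrix.diagonal q).mulVec (φ t) + r) ⬝ᵥ
      L.mulVec ((Matrix.diagonal q).mulVec (φ t) + r) = 0) :
    cw h (x 0) = ybar ∧ cw g (θ 0) = uOpt q r d ∧ φ 0 = uOpt q r d ∧
      G.inc.mulVec (cw f (μ 0)) = (selE n p).mulVec (uOpt q r d) - d := by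
  have hgφ : ∀ t, cw g (θ t) - φ t = 0 := by
    intro t
    have h1 := lap_nonneg hL ((Matrix.diagonal q).mulVec (φ t) + r)
    have h2 : 0 ≤ (cw g (θ t) - φ t) ⬝ᵥ (cw g (θ t) - φ t) :=
      Finset.sum_nonneg fun i _ => mul_self_nonneg _
    exact dotProduct_self_eq_zero.1 (by linarith [hdis t])
  have hw : ∀ t i j, ((Matrix.diagonal q).mulVec (φ t) + r) i =
      ((Matrix.diagonal q).mulVec (φ t) + r) j := by
    intro t
    refine lap_zero hL _ ?_
    have := hdis t
    rw [hgφ t, dotProduct_zero] at this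
    linarith
  have hφc : ∀ s t i, φ s i = φ t i := fun s t i =>
    const_of_deriv_zero (u := fun s => φ s i) (fun t => by
      have := hφode t i
      rw [lap_const hL _ (hw t), hgφ t] at this
      simpa using this) s t
  have hgc : ∀ s t, cw g (θ s) = cw g (θ t) := by
    intro s t
    rw [sub_eq_zero.1 (hgφ s), sub_eq_zero.1 (hgφ t)]
    funext i; exact hφc s t i
  have hθc : ∀ s t i, θ s i = θ t i := fun s t i => (hg i).injective (congrFun (hgc s t) i)
  have hθ0 : ∀ t i, (cw h (x t) - ybar) (Fin.castLE hpn i) = 0 := by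
    intro t i
    have h1 := hθode t i
    have h2 : HasDerivAt (fun s => θ s i) 0 t := by
      have : (fun s => θ s i) = fun _ => θ 0 i := by funext s; exact hθc s 0 i
      rw [this]; exact hasDerivAt_const _ _
    have h3 := h1.unique h2
    rw [hgφ t, sub_zero, Pi.neg_apply, selET hpn, div_eq_zero_iff] at h3
    rcases h3 with h3 | h3
    · exact neg_eq_zero.1 h3
    · exact absurd h3 (hTth i).ne'
  have hbal : ∀ i, (∀ t, (cw h (x t) - ybar) i = 0) → ∀ t,
      G.inc.mulVec (cw f (μ t)) i = ((selE n p).mulVec (cw g (θ t)) - d) i := by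
    intro i hi t
    have hx : ∀ s, x s i = x t i := fun s => (hh i).injective (by
      have h1 := hi s
      have h2 := hi t
      simp only [cw, Pi.sub_apply] at h1 h2
      linarith)
    have h2 : HasDerivAt (fun s => x s i) 0 t := by
      have : (fun s => x s i) = fun _ => x t i := by funext s; exact hx s
      rw [this]; exact hasDerivAt_const _ _
    have h3 := (hxode t i).unique h2
    rw [div_eq_zero_iff] at h3
    have h4 := h3.resolve_right (hTx i).ne'
    simp only [Pi.add_apply, Pi.sub_apply, Pi.neg_apply] at h4 ⊢
    linarith
  have hS : ∀ k : ℕ, ∀ i ∈ (zfStep G)^[k] {i : Fin n | (i : ℕ) < p}, ∀ t,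
      (cw h (x t) - ybar) i = 0 := by
    intro k
    induction k with
    | zero =>
      intro i hi t
      exact hθ0 t ⟨i, hi⟩
    | succ k ih =>
      rw [Function.iterate_succ_apply']
      refine zf_step G f hf Tm hTm (fun t => cw h (x t) - ybar) μ hμode _ ih ?_
      intro i hi s t
      rw [hbal i (ih i hi) s, hbal i (ih i hi) t, hgc s t]
  obtain ⟨k, hk⟩ := hzf
  have hall : ∀ i t, (cw h (x t) - ybar) i = 0 := fun i => hS k i (by rw [hk]; trivial)
  have hB : G.inc.mulVec (cw f (μ 0)) = (selE n p).mulVec (φ 0) - d := by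
    rw [← sub_eq_zero.1 (hgφ 0)]
    funext i; exact hbal i (hall i) 0
  have hφ0 : φ 0 = uOpt q r d := by
    have hsum : ∑ i, φ 0 i = ∑ i, d i := by
      have h1 := sum_inc G (cw f (μ 0))
      rw [hB] at h1
      simp only [Pi.sub_apply, Finset.sum_sub_distrib, sum_selE hpn] at h1
      linarith
    let i0 : Fin p := ⟨0, hp⟩
    set c := q i0 * φ 0 i0 + r i0 with hc
    have hci : ∀ i, φ 0 i = c * (q i)⁻¹ - r i / q i := by
      intro i
      have h1 := hw 0 i i0
      simp only [Pi.add_apply, Matrix.mulVec_diagonal] at h1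
      rw [← hc] at h1
      have := (hq i).ne'
      field_simp
      linarith
    have hpos : 0 < ∑ i, (q i)⁻¹ :=
      Finset.sum_pos (fun i _ => inv_pos.2 (hq i)) ⟨i0, Finset.mem_univ _⟩
    have hcl : c = lamStar q r d := by
      unfold lamStar
      rw [eq_div_iff hpos.ne', ← hsum]
      simp only [hci, Finset.sum_sub_distrib, ← Finset.mul_sum]
      ring
    funext i
    rw [hci i, hcl, uOpt]
    ring
  refine ⟨?_, ?_, hφ0, ?_⟩
  · funext i
    exact sub_eq_zero.1 (hall i 0)
  · rw [sub_eq_zero.1 (hgφ 0), hφ0]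
  · rw [hB, hφ0]

/-- **Theorem 3.** If the set of actuated nodes is a zero forcing set,
then every solution of the flow network with potential-induced flow dynamics
`T_μ μ̇ = Bᵀ(h(x) − ȳ)` in closed loop with the input controllers respects the flow
and input constraints for all `t ≥ 0` and converges to a point with `h(x*) = ȳ`,
`g(θ*) = ū` and `B f(μ*) = Eū − d`. -/
theorem zero_forcing_convergence {n m p : ℕ} (hp : 0 < p) (hpn : p ≤ n)
    (G : OrientedGraph n m) (hG : G.Connected)
    (h : Fin n → ℝ → ℝ) (hh : ∀ i, ContDiff ℝ 1 (h i) ∧ StrictMono (h i))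
    (f : Fin m → ℝ → ℝ) (hf : ∀ k, ContDiff ℝ 1 (f k) ∧ StrictMono (f k))
    (g : Fin p → ℝ → ℝ) (hg : ∀ i, ContDiff ℝ 1 (g i) ∧ StrictMono (g i))
    (lamlo lamhi : Fin m → ℝ) (hfr : ∀ k, Set.range (f k) = Set.Ioo (lamlo k) (lamhi k))
    (ulo uhi : Fin p → ℝ) (hgr : ∀ i, Set.range (g i) = Set.Ioo (ulo i) (uhi i))
    (q r : Fin p → ℝ) (hq : ∀ i, 0 < q i) (d ybar : Fin n → ℝ)
    (hy : ∀ i, ybar i ∈ Set.range (h i))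
    (hu : ∀ i, uOpt q r d i ∈ Set.range (g i))
    (hlam : ∃ lb : Fin m → ℝ,
      G.inc.mulVec lb = (selE n p).mulVec (uOpt q r d) - d ∧
      ∀ k, lb k ∈ Set.range (f k))
    (L : Matrix (Fin p) (Fin p) ℝ) (hL : IsBalancedStronglyConnectedLaplacian L)
    -- the actuated nodes form a zero forcing set
    (hzf : IsZeroForcingSet G {i : Fin n | (i : ℕ) < p})
    (Tx : Fin n → ℝ) (Tm : Fin m → ℝ) (Tth Tph : Fin p → ℝ)
    (hTx : ∀ i, 0 < Tx i) (hTm : ∀ k, 0 < Tm k)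
    (hTth : ∀ i, 0 < Tth i) (hTph : ∀ i, 0 < Tph i)
    -- a solution of the closed-loop system on [0, ∞)
    (x : ℝ → Fin n → ℝ) (μ : ℝ → Fin m → ℝ) (θ φ : ℝ → Fin p → ℝ)
    (hxode : ∀ t, 0 ≤ t → ∀ i, HasDerivAt (fun s => x s i)
      (((-(G.inc.mulVec (cw f (μ t))) + (selE n p).mulVec (cw g (θ t)) - d) i) / Tx i) t)
    (hμode : ∀ t, 0 ≤ t → ∀ k, HasDerivAt (fun s => μ s k)
      ((((G.inc)ᵀ.mulVec (cw h (x t) - ybar)) k) / Tm k) t)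
    (hθode : ∀ t, 0 ≤ t → ∀ i, HasDerivAt (fun s => θ s i)
      (((-((selE n p)ᵀ.mulVec (cw h (x t) - ybar)) - (cw g (θ t) - φ t)) i) / Tth i) t)
    (hφode : ∀ t, 0 ≤ t → ∀ i, HasDerivAt (fun s => φ s i)
      (((cw g (θ t) - φ t -
        (Matrix.diagonal q).mulVec (L.mulVec ((Matrix.diagonal q).mulVec (φ t) + r))) i)
        / Tph i) t) :
    -- constraints hold for all t ≥ 0
    (∀ t, 0 ≤ t →
      (∀ k, lamlo k < f k (μ t k) ∧ f k (μ t k) < lamhi k) ∧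
      (∀ i, ulo i < g i (θ t i) ∧ g i (θ t i) < uhi i)) ∧
    -- convergence to an optimal steady state
    (∃ (xs : Fin n → ℝ) (ms : Fin m → ℝ) (ths phs : Fin p → ℝ),
      Tendsto x atTop (𝓝 xs) ∧ Tendsto μ atTop (𝓝 ms) ∧
      Tendsto θ atTop (𝓝 ths) ∧ Tendsto φ atTop (𝓝 phs) ∧
      cw h xs = ybar ∧ cw g ths = uOpt q r d ∧
      G.inc.mulVec (cw f ms) = (selE n p).mulVec (uOpt q r d) - d) := by
  refine ⟨fun t _ => ⟨fun k => ?_, fun i => ?_⟩, ?_⟩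
  · have : f k (μ t k) ∈ Set.range (f k) := ⟨_, rfl⟩
    rwa [hfr k] at this
  · have : g i (θ t i) ∈ Set.range (g i) := ⟨_, rfl⟩
    rwa [hgr i] at this
  let ι := Fin n ⊕ (Fin m ⊕ (Fin p ⊕ Fin p))
  let σ : ι → ℝ → ℝ := Sum.elim h (Sum.elim f (Sum.elim g (fun _ => id)))
  let T : ι → ℝ := Sum.elim Tx (Sum.elim Tm (Sum.elim Tth Tph))
  let zx : (ι → ℝ) → Fin n → ℝ := fun z i => z (Sum.inl i)
  let zm : (ι → ℝ) → Fin m → ℝ := fun z i => z (Sum.inr (Sum.inl i))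
  let zt : (ι → ℝ) → Fin p → ℝ := fun z i => z (Sum.inr (Sum.inr (Sum.inl i)))
  let zp : (ι → ℝ) → Fin p → ℝ := fun z i => z (Sum.inr (Sum.inr (Sum.inr i)))
  let F : (ι → ℝ) → ι → ℝ := fun z =>
    Sum.elim (-(G.inc.mulVec (cw f (zm z))) + (selE n p).mulVec (cw g (zt z)) - d)
    (Sum.elim ((G.inc)ᵀ.mulVec (cw h (zx z) - ybar))
    (Sum.elim (-((selE n p)ᵀ.mulVec (cw h (zx z) - ybar)) - (cw g (zt z) - zp z))
      (cw g (zt z) - zp z -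
        (Matrix.diagonal q).mulVec (L.mulVec ((Matrix.diagonal q).mulVec (zp z) + r)))))
  let Q : (ι → ℝ) → Prop := fun z => cw h (zx z) = ybar ∧ cw g (zt z) = uOpt q r d ∧
    zp z = uOpt q r d ∧ G.inc.mulVec (cw f (zm z)) = (selE n p).mulVec (uOpt q r d) - d
  have hσ : ∀ i, Continuous (σ i) := by
    rintro (i | i | i | i)
    · exact (hh i).1.continuous
    · exact (hf i).1.continuous
    · exact (hg i).1.continuous
    · exact continuous_id
  have hm : ∀ i, StrictMono (σ i) := by
    rintro (i | i | i | i)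
    · exact (hh i).2
    · exact (hf i).2
    · exact (hg i).2
    · exact strictMono_id
  have hT : ∀ i, 0 < T i := by
    rintro (i | i | i | i)
    · exact hTx i
    · exact hTm i
    · exact hTth i
    · exact hTph i
  have ch : Continuous fun z => cw h (zx z) :=
    continuous_pi fun i => (hh i).1.continuous.comp (continuous_apply _)
  have cf : Continuous fun z => cw f (zm z) :=
    continuous_pi fun i => (hf i).1.continuous.comp (continuous_apply _)
  have cg : Continuous fun z => cw g (zt z) :=
    continuous_pi fun i => (hg i).1.continuous.comp (continuous_apply _)
  have cp : Continuous fun z => zp z := continuous_pi fun i => continuous_apply _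
  have hF : Continuous F := by
    refine continuous_pi ?_
    rintro (i | i | i | i)
    · exact (continuous_apply i).comp
        ((((continuous_const.matrix_mulVec cf).neg).add
          (continuous_const.matrix_mulVec cg)).sub continuous_const)
    · exact (continuous_apply i).comp
        (continuous_const.matrix_mulVec (ch.sub continuous_const))
    · exact (continuous_apply i).comp
        ((continuous_const.matrix_mulVec (ch.sub continuous_const)).neg.sub (cg.sub cp))
    · exact (continuous_apply i).comp
        ((cg.sub cp).sub (continuous_const.matrix_mulVec (continuous_const.matrix_mulVec
          ((continuous_const.matrix_mulVec cp).add continuous_const))))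
  have hdiss : ∀ zb, Q zb → ∀ z, ∑ i, (σ i (z i) - σ i (zb i)) * F z i =
      -((cw g (zt z) - zp z) ⬝ᵥ (cw g (zt z) - zp z)) -
      ((Matrix.diagonal q).mulVec (zp z) + r) ⬝ᵥ
      L.mulVec ((Matrix.diagonal q).mulVec (zp z) + r) := by
    rintro zb ⟨h1, h2, h3, h4⟩ z
    rw [← dissip G.inc (selE n p) q r hL d (cw h (zx z) - ybar) (cw f (zm z)) (cw f (zm zb))
      (cw g (zt z)) (zp z) (uOpt q r d) _ (q_uOpt q r hq d) h4]
    refine (Fintype.sum_sum_type _).trans ?_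
    rw [Fintype.sum_sum_type, Fintype.sum_sum_type]
    have e1 : ∀ i, ybar i = h i (zx zb i) := fun i => (congrFun h1 i).symm
    have e2 : ∀ i, uOpt q r d i = g i (zt zb i) := fun i => (congrFun h2 i).symm
    have e3 : ∀ i, uOpt q r d i = zp zb i := fun i => (congrFun h3 i).symm
    refine congrArg₂ (· + ·) (Finset.sum_congr rfl fun i _ => ?_) (congrArg₂ (· + ·) rfl
      (congrArg₂ (· + ·) (Finset.sum_congr rfl fun i _ => ?_)
        (Finset.sum_congr rfl fun i _ => ?_)))
    · rw [Pi.sub_apply _ ybar, e1]; rfl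
    · rw [Pi.sub_apply _ (uOpt q r d), e2]; rfl
    · rw [Pi.sub_apply _ (uOpt q r d), e3]; rfl
  obtain ⟨zs, ⟨h1, h2, h3, h4⟩, hlim⟩ := abstract_lasalle (σ := σ) (T := T) hσ hm hT hF Q
    (by
      intro zb hQ z
      rw [hdiss zb hQ z]
      have h1 := lap_nonneg hL ((Matrix.diagonal q).mulVec (zp z) + r)
      have h2 : 0 ≤ (cw g (zt z) - zp z) ⬝ᵥ (cw g (zt z) - zp z) :=
        Finset.sum_nonneg fun i _ => mul_self_nonneg _
      linarith)
    (by
      obtain ⟨lb, hlb, hlr⟩ := hlam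
      choose xb hxb using hy
      choose tb htb using hu
      choose mb hmb using hlr
      refine ⟨Sum.elim xb (Sum.elim mb (Sum.elim tb (uOpt q r d))), funext hxb, funext htb,
        rfl, ?_⟩
      rw [← hlb]
      congr 1
      exact funext hmb)
    (by
      intro zb hQ y hy' hdis
      exact invariant_analysis hp hpn G h (fun i => (hh i).2) f (fun i => (hf i).2) g
        (fun i => (hg i).2) q r hq d ybar L hL hzf Tx Tm Tth Tph hTx hTm hTth
        (fun t => zx (y t)) (fun t => zm (y t)) (fun t => zt (y t)) (fun t => zp (y t))
        (fun t i => hy' t (Sum.inl i)) (fun t i => hy' t (Sum.inr (Sum.inl i)))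
        (fun t i => hy' t (Sum.inr (Sum.inr (Sum.inl i))))
        (fun t i => hy' t (Sum.inr (Sum.inr (Sum.inr i))))
        (fun t => (hdiss zb hQ (y t)).symm.trans (hdis t)))
    (z := fun t => Sum.elim (x t) (Sum.elim (μ t) (Sum.elim (θ t) (φ t))))
    (by
      rintro t ht (i | i | i | i)
      · exact hxode t ht i
      · exact hμode t ht i
      · exact hθode t ht i
      · exact hφode t ht i)
  rw [tendsto_pi_nhds] at hlim
  exact ⟨zx zs, zm zs, zt zs, zp zs,
    tendsto_pi_nhds.2 fun i => hlim (Sum.inl i),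
    tendsto_pi_nhds.2 fun i => hlim (Sum.inr (Sum.inl i)),
    tendsto_pi_nhds.2 fun i => hlim (Sum.inr (Sum.inr (Sum.inl i))),
    tendsto_pi_nhds.2 fun i => hlim (Sum.inr (Sum.inr (Sum.inr i))), h1, h2, h4⟩
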